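/- Bi-static successive-scheme inner bound: Under the standing assumption, for every probability distribution P_X on 𝒳 and every R > 0, every pair (R,E) ∈ ℝ₊² with R ≤ min_{s∈𝒮} I(P_X, W_{Y|X,s}) and E ≤ min( ρ_succ(P_X,R), φ(P_X) ) belongs to the closure C^(b) of the set of achievable rate/detection-error-exponent pairs of the bi-static joint communication and sensing model. -/

import Mathlib

open scoped BigOperators ENNReal NNReal

namespace JCAS

variable {𝒳 𝒴 𝒵 𝒮 : Type}

/-- `p` is a probability mass function on the finite alphabet `𝒳`. -/
def IsPMF [Fintype 𝒳] (p : 𝒳 → ℝ) : Prop :=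
  (∀ x, 0 ≤ p x) ∧ ∑ x, p x = 1

/-- `V` is a channel (conditional probability distribution) from `𝒳` to `𝒴`. -/
def IsChannel [Fintype 𝒳] [Fintype 𝒴] (V : 𝒳 → 𝒴 → ℝ) : Prop :=
  ∀ x, IsPMF (V x)

/-- Mutual information `I(P, V)` (natural logarithm), with `0·log(0/a) = 0`. -/
noncomputable def mutualInfo [Fintype 𝒳] [Fintype 𝒴] (P : 𝒳 → ℝ) (V : 𝒳 → 𝒴 → ℝ) : ℝ :=
  ∑ x, ∑ y, P x * V x y * Real.log (V x y / ∑ x', P x' * V x' y)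

/-- `a ^ ℓ` with the convention `0 ^ ℓ = 0` (in particular `0 ^ 0 = 0`). -/
noncomputable def pow0 (a ℓ : ℝ) : ℝ := if a = 0 then 0 else a ^ ℓ

/-- `Σ_z W(z)^ℓ · W'(z)^{1-ℓ}`. -/
noncomputable def chernoffSum [Fintype 𝒵] (W W' : 𝒵 → ℝ) (ℓ : ℝ) : ℝ :=
  ∑ z, pow0 (W z) ℓ * pow0 (W' z) (1 - ℓ)

/-- Chernoff information between the channels `W` and `W'` under input distribution `P`:
`max_{ℓ∈[0,1]} −Σ_x P(x) log( Σ_z W(z|x)^ℓ W'(z|x)^{1−ℓ} )`. -/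
noncomputable def chernoffPair [Fintype 𝒳] [Fintype 𝒵] (P : 𝒳 → ℝ) (W W' : 𝒳 → 𝒵 → ℝ) : ℝ :=
  sSup ((fun ℓ => -∑ x, P x * Real.log (chernoffSum (W x) (W' x) ℓ)) '' Set.Icc (0 : ℝ) 1)

/-- `ψ_s(P) = min_{s' ≠ s} (Chernoff information between `W_s` and `W_{s'}` under `P`)`. -/
noncomputable def psi [Fintype 𝒳] [Fintype 𝒵] (WZ : 𝒮 → 𝒳 → 𝒵 → ℝ) (P : 𝒳 → ℝ) (s : 𝒮) : ℝ :=
  sInf ((fun s' => chernoffPair P (WZ s) (WZ s')) '' {s' : 𝒮 | s' ≠ s})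

/-- Chernoff detection-error exponent `φ(P) = min_s ψ_s(P)`. -/
noncomputable def phi [Fintype 𝒳] [Fintype 𝒵] (WZ : 𝒮 → 𝒳 → 𝒵 → ℝ) (P : 𝒳 → ℝ) : ℝ :=
  ⨅ s, psi WZ P s

/-- Standing assumption: for all `s ≠ s'` the best Chernoff information is positive. -/
def StandingAssumption [Fintype 𝒳] [Fintype 𝒵] (WZ : 𝒮 → 𝒳 → 𝒵 → ℝ) : Prop :=
  ∀ s s' : 𝒮, s ≠ s' →
    0 < sSup ((fun P => chernoffPair P (WZ s) (WZ s')) '' {P : 𝒳 → ℝ | IsPMF P})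

/-- Empirical distribution (type) of a sequence `x ∈ 𝒳ⁿ`. -/
noncomputable def empDist [Fintype 𝒳] [DecidableEq 𝒳] {n : ℕ} (x : Fin n → 𝒳) (a : 𝒳) : ℝ :=
  (Finset.univ.filter (fun i => x i = a)).card / n

open Classical in
/-- Probability of an event `A` on `Yⁿ` when the codeword `x` is sent over the bi-static
channel in state `s`. -/
noncomputable def biProbEvent [Fintype 𝒴] {n : ℕ} (W : 𝒮 → 𝒳 → 𝒴 → ℝ)
    (x : Fin n → 𝒳) (s : 𝒮) (A : (Fin n → 𝒴) → Prop) : ℝ :=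
  ∑ y : Fin n → 𝒴, if A y then ∏ i, W s (x i) (y i) else 0

/-- `(R, E)` is an achievable rate / detection-error-exponent pair for the bi-static model. -/
def BiAchievable [Fintype 𝒳] [Fintype 𝒴] (W : 𝒮 → 𝒳 → 𝒴 → ℝ) (R E : ℝ) : Prop :=
  ∀ ε > (0 : ℝ), ∃ (n M : ℕ) (f : Fin M → Fin n → 𝒳)
      (g : (Fin n → 𝒴) → 𝒮) (h : (Fin n → 𝒴) → Fin M),
    0 < n ∧ 0 < M ∧
    R - ε ≤ Real.log M / n ∧
    (∀ (s : 𝒮) (w : Fin M), biProbEvent W (f w) s (fun y => h y ≠ w) ≤ ε) ∧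
    (∀ (s : 𝒮) (w : Fin M),
      biProbEvent W (f w) s (fun y => g y ≠ s) ≤ Real.exp (-(n : ℝ) * (E - ε)))

/-- `C^(b)`: closure of the set of achievable pairs in `ℝ₊²` for the bi-static model. -/
def Cbi [Fintype 𝒳] [Fintype 𝒴] (W : 𝒮 → 𝒳 → 𝒴 → ℝ) : Set (ℝ × ℝ) :=
  closure {p : ℝ × ℝ | 0 ≤ p.1 ∧ 0 ≤ p.2 ∧ BiAchievable W p.1 p.2}

/-- Conditional entropy `H(Q | P)` (natural logarithm). -/
noncomputable def condH [Fintype 𝒳] [Fintype 𝒴] (P : 𝒳 → ℝ) (Q : 𝒳 → 𝒴 → ℝ) : ℝ :=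
  -∑ x, ∑ y, P x * Q x y * Real.log (Q x y)

/-- Output distribution `(P ∘ Q)(y) = Σ_x P(x) Q(y|x)`. -/
noncomputable def outDist [Fintype 𝒳] (P : 𝒳 → ℝ) (Q : 𝒳 → 𝒴 → ℝ) (y : 𝒴) : ℝ :=
  ∑ x, P x * Q x y

/-- Shannon entropy of a distribution on `𝒴` (natural logarithm). -/
noncomputable def ent [Fintype 𝒴] (Q : 𝒴 → ℝ) : ℝ := -∑ y, Q y * Real.log (Q y)

open Classical in
/-- Conditional relative entropy `D(Q ‖ V | P)`, equal to `+∞` when absolute continuity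
fails. -/
noncomputable def condKL [Fintype 𝒳] [Fintype 𝒴] (P : 𝒳 → ℝ) (Q V : 𝒳 → 𝒴 → ℝ) : ℝ≥0∞ :=
  if ∀ x y, P x * Q x y ≠ 0 → V x y ≠ 0 then
    ENNReal.ofReal (∑ x, ∑ y, P x * Q x y * Real.log (Q x y / V x y))
  else ⊤

/-- Successive-scheme exponent
`ρ_succ(P,R) = min_s inf_{Q} [ D(Q‖W_s|P) + |I(P,Q) − R|⁺ ]`, in `ℝ≥0∞`. -/
noncomputable def rhoSucc [Fintype 𝒳] [Fintype 𝒴] (W : 𝒮 → 𝒳 → 𝒴 → ℝ)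
    (P : 𝒳 → ℝ) (R : ℝ) : ℝ≥0∞ :=
  ⨅ s, ⨅ Q ∈ {Q : 𝒳 → 𝒴 → ℝ | IsChannel Q},
    condKL P Q (W s) + ENNReal.ofReal (mutualInfo P Q - R)

/-- `β(Q,P,R,s)`: infimum of `D(Q''‖W_s|P) + H(Q''|P)` over channels `Q''` with
`I(P,Q'') < R` and `P∘Q'' = P∘Q` (`+∞` if no such channel exists). -/
noncomputable def beta [Fintype 𝒳] [Fintype 𝒴] (W : 𝒮 → 𝒳 → 𝒴 → ℝ) (Q : 𝒳 → 𝒴 → ℝ)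
    (P : 𝒳 → ℝ) (R : ℝ) (s : 𝒮) : ℝ≥0∞ :=
  ⨅ Q'' ∈ {Q'' : 𝒳 → 𝒴 → ℝ | IsChannel Q'' ∧ mutualInfo P Q'' < R ∧
      ∀ y, outDist P Q'' y = outDist P Q y},
    condKL P Q'' (W s) + ENNReal.ofReal (condH P Q'')

/-- The set `P_{s,s'}(Q,P,R)` of conditional distributions. -/
def PSet [Fintype 𝒳] [Fintype 𝒴] (W : 𝒮 → 𝒳 → 𝒴 → ℝ) (Q : 𝒳 → 𝒴 → ℝ)
    (P : 𝒳 → ℝ) (R : ℝ) (s s' : 𝒮) : Set (𝒳 → 𝒴 → ℝ) :=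
  {Q' | IsChannel Q' ∧
    condKL P Q' (W s') + ENNReal.ofReal (condH P Q')
      ≤ min (beta W Q P R s) (condKL P Q (W s) + ENNReal.ofReal (condH P Q)) ∧
    ∀ y, outDist P Q' y = outDist P Q y}

/-- Joint decoding-and-detection exponent `ρ_joint(P,R)`, in `ℝ≥0∞`; truncated
subtraction implements `|·−R|⁺` and an infimum over an empty set is `+∞`. -/
noncomputable def rhoJoint [Fintype 𝒳] [Fintype 𝒴] (W : 𝒮 → 𝒳 → 𝒴 → ℝ)
    (P : 𝒳 → ℝ) (R : ℝ) : ℝ≥0∞ :=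
  ⨅ s, ⨅ Q ∈ {Q : 𝒳 → 𝒴 → ℝ | IsChannel Q},
    condKL P Q (W s) +
      ((⨅ s' ∈ {s' : 𝒮 | s' ≠ s}, ⨅ Q' ∈ PSet W Q P R s s',
          ENNReal.ofReal (mutualInfo P Q')) - ENNReal.ofReal R)

/-- `γ₁(Q,R,s) = D(Q‖W_s|P) + |I(P,Q) − R|⁺`. -/
noncomputable def gamma1 [Fintype 𝒳] [Fintype 𝒴] (W : 𝒮 → 𝒳 → 𝒴 → ℝ) (P : 𝒳 → ℝ)
    (Q : 𝒳 → 𝒴 → ℝ) (R : ℝ) (s : 𝒮) : ℝ≥0∞ :=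
  condKL P Q (W s) + ENNReal.ofReal (mutualInfo P Q - R)

/-- `γ₂(Q,R,s) = D(Q‖W_s|P) + | D(Q‖W_s|P) + H(P∘Q) − β(Q,P,R,s) − R |⁺`. -/
noncomputable def gamma2 [Fintype 𝒳] [Fintype 𝒴] (W : 𝒮 → 𝒳 → 𝒴 → ℝ) (P : 𝒳 → ℝ)
    (Q : 𝒳 → 𝒴 → ℝ) (R : ℝ) (s : 𝒮) : ℝ≥0∞ :=
  condKL P Q (W s) +
    ((condKL P Q (W s) + ENNReal.ofReal (ent (outDist P Q)) - beta W Q P R s)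
      - ENNReal.ofReal R)

/-- `P'_{Y|X}(P,R,s)`: channels `Q` with `max_{s''} β(Q,P,R,s'') ≥ D(Q‖W_s|P) + H(Q|P)`. -/
def PsetPrime [Fintype 𝒳] [Fintype 𝒴] [Fintype 𝒮] (W : 𝒮 → 𝒳 → 𝒴 → ℝ) (P : 𝒳 → ℝ)
    (R : ℝ) (s : 𝒮) : Set (𝒳 → 𝒴 → ℝ) :=
  {Q | IsChannel Q ∧
    condKL P Q (W s) + ENNReal.ofReal (condH P Q) ≤ ⨆ s'', beta W Q P R s''}

/-- `P''_{Y|X}(P,R,s)`: channels `Q` with `max_{s''} β(Q,P,R,s'') < D(Q‖W_s|P) + H(Q|P)`. -/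
def PsetDoublePrime [Fintype 𝒳] [Fintype 𝒴] [Fintype 𝒮] (W : 𝒮 → 𝒳 → 𝒴 → ℝ) (P : 𝒳 → ℝ)
    (R : ℝ) (s : 𝒮) : Set (𝒳 → 𝒴 → ℝ) :=
  {Q | IsChannel Q ∧
    (⨆ s'', beta W Q P R s'') < condKL P Q (W s) + ENNReal.ofReal (condH P Q)}

section RandomCoding

open Finset

theorem sum_prod_mul {ι α : Type} [Fintype ι] [DecidableEq ι] [Fintype α] (p : α → ℝ)
    (hp : ∑ a, p a = 1) (i : ι) (u : α → ℝ) :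
    ∑ f : ι → α, (∏ k, p (f k)) * u (f i) = ∑ a, p a * u a := by
  classical
  have h := Finset.prod_univ_sum (fun _ : ι => (univ : Finset α))
    (fun k a => p a * (if k = i then u a else 1))
  rw [Fintype.piFinset_univ] at h
  simp only [prod_mul_distrib, prod_ite_eq', mem_univ, if_true] at h
  rw [← h, ← Finset.mul_prod_erase univ _ (mem_univ i), prod_eq_one]
  · simp
  · intro k hk
    simp [(mem_erase.1 hk).1, hp]

theorem sum_prod_mul_mul {ι α : Type} [Fintype ι] [DecidableEq ι] [Fintype α] (p : α → ℝ)
    (hp : ∑ a, p a = 1) {i j : ι} (hij : i ≠ j) (u v : α → ℝ) :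
    ∑ f : ι → α, (∏ k, p (f k)) * (u (f i) * v (f j)) =
      (∑ a, p a * u a) * ∑ a, p a * v a := by
  classical
  have h := Finset.prod_univ_sum (fun _ : ι => (univ : Finset α))
    (fun k a => p a * ((if k = i then u a else 1) * (if k = j then v a else 1)))
  rw [Fintype.piFinset_univ] at h
  simp only [prod_mul_distrib, prod_ite_eq', mem_univ, if_true] at h
  rw [← h, ← Finset.mul_prod_erase univ _ (mem_univ i),
    ← Finset.mul_prod_erase (univ.erase i) _ (mem_erase.2 ⟨hij.symm, mem_univ j⟩), prod_eq_one]
  · simp [hij, hij.symm]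
  · intro k hk
    simp only [mem_erase] at hk
    simp [hk.1, hk.2.1, hp]

theorem sum_prod_mul_pair {ι α : Type} [Fintype ι] [DecidableEq ι] [Fintype α] (p : α → ℝ)
    (hp : ∑ a, p a = 1) {i j : ι} (hij : i ≠ j) (G : α → α → ℝ) :
    ∑ f : ι → α, (∏ k, p (f k)) * G (f i) (f j) = ∑ a, p a * ∑ b, p b * G a b := by
  classical
  have h : ∀ f : ι → α, (∏ k, p (f k)) * G (f i) (f j) =
      ∑ a, (∏ k, p (f k)) * ((if f i = a then 1 else 0) * G a (f j)) := by
    intro f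
    simp
  simp only [h]
  rw [sum_comm]
  refine sum_congr rfl fun a _ => ?_
  rw [sum_prod_mul_mul p hp hij (fun x => if x = a then 1 else 0) (G a)]
  simp

theorem exists_pos_and_le_of_sum_le {Ω : Type} [Fintype Ω] (m : Ω → ℝ) (hm : IsPMF m)
    (c : Ω → ℝ) (b : ℝ) (h : ∑ f, m f * c f ≤ b) : ∃ f, 0 < m f ∧ c f ≤ b := by
  by_contra! H
  have hpos : ∃ f, 0 < m f := by
    by_contra! H'
    have : ∑ f, m f ≤ 0 := sum_nonpos fun f _ => H' f
    rw [hm.2] at this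
    linarith
  obtain ⟨f₀, hf₀⟩ := hpos
  have : ∑ f, m f * b < ∑ f, m f * c f := by
    refine sum_lt_sum (fun f _ => ?_) ⟨f₀, mem_univ _, ?_⟩
    · rcases (hm.1 f).eq_or_lt with h0 | h0
      · simp [← h0]
      · exact mul_le_mul_of_nonneg_left (H f h0).le h0.le
    · exact mul_lt_mul_of_pos_left (H f₀ hf₀) hf₀
  rw [← sum_mul, hm.2] at this
  linarith

theorem exists_half_le {M : ℕ} (e : Fin (2 * M) → ℝ) (he : ∀ i, 0 ≤ e i) (b : ℝ) (hM : 0 < M)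
    (h : ∑ i, e i ≤ (2 * M : ℕ) * b) :
    ∃ φ : Fin M → Fin (2 * M), Function.Injective φ ∧ ∀ i, e (φ i) ≤ 2 * b := by
  classical
  set s := univ.filter fun i => e i ≤ 2 * b with hs
  have hb : 0 ≤ b := by
    have h0 : 0 ≤ ∑ i, e i := sum_nonneg fun i _ => he i
    have : (0 : ℝ) < (2 * M : ℕ) := by exact_mod_cast (by omega : 0 < 2 * M)
    nlinarith
  have hcard : M ≤ s.card := by
    by_contra! hlt
    have hc : M < (sᶜ).card := by
      rw [card_compl, Fintype.card_fin]; omega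
    have hne : (sᶜ).Nonempty := card_pos.1 (by omega)
    have h1 : (sᶜ).card • (2 * b) < ∑ i ∈ sᶜ, e i := by
      rw [← sum_const]
      refine sum_lt_sum_of_nonempty hne fun i hi => ?_
      simpa [hs] using hi
    have h2 : ∑ i ∈ sᶜ, e i ≤ ∑ i, e i :=
      sum_le_sum_of_subset_of_nonneg (subset_univ _) fun i _ _ => he i
    have h3 : (M : ℝ) ≤ (sᶜ).card := by exact_mod_cast hc.le
    rw [nsmul_eq_mul] at h1
    push_cast at h
    nlinarith
  exact ⟨fun i => s.orderEmbOfCardLe hcard i, fun i j hij => by simpa using hij,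
    fun i => (mem_filter.1 (s.orderEmbOfCardLe_mem hcard i)).2⟩

open Classical in
/-- Probability, under the codeword distribution `μ`, of having the same joint class with `y`
as `x` has. -/
noncomputable def classProb {α β T : Type} [Fintype α] (μ : α → ℝ) (jt : α → β → T)
    (x : α) (y : β) : ℝ :=
  ∑ x', if jt x' y = jt x y then μ x' else 0

open Classical in
theorem sum_classProb_le {α β T : Type} [Fintype α] [Fintype T] (μ : α → ℝ)
    (hμ : ∀ x, 0 ≤ μ x) (jt : α → β → T) (x : α) (y : β) :
    (∑ x', if classProb μ jt x' y ≤ classProb μ jt x y then μ x' else 0) ≤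
      Fintype.card T * classProb μ jt x y := by
  have hq : 0 ≤ classProb μ jt x y := sum_nonneg fun x' _ => by split_ifs <;> simp [hμ]
  rw [← sum_fiberwise univ (fun x' => jt x' y)]
  have : (Fintype.card T : ℝ) * classProb μ jt x y = ∑ _t : T, classProb μ jt x y := by
    simp
  rw [this]
  refine sum_le_sum fun t _ => ?_
  by_cases h : ∃ x₁, jt x₁ y = t ∧ classProb μ jt x₁ y ≤ classProb μ jt x y
  · obtain ⟨x₁, rfl, h₁⟩ := h
    refine le_trans ?_ h₁
    rw [classProb, sum_filter]
    refine sum_le_sum fun x' _ => ?_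
    split_ifs <;> simp [hμ]
  · push Not at h
    refine le_trans (le_of_eq (sum_eq_zero fun x' hx' => ?_)) hq
    rw [if_neg (not_le.2 (h x' (mem_filter.1 hx').2))]

open Classical in
theorem exists_codebook {α β T S : Type} [Fintype α] [Fintype β] [Fintype T] [Fintype S]
    (μ : α → ℝ) (hμ : IsPMF μ) (w : S → α → β → ℝ) (hw : ∀ s x y, 0 ≤ w s x y)
    (jt : α → β → T) (M : ℕ) :
    ∃ f : Fin M → α, (∀ i, 0 < μ (f i)) ∧
      ∑ i, ∑ s, ∑ y, (if ∃ j, j ≠ i ∧ classProb μ jt (f j) y ≤ classProb μ jt (f i) y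
        then w s (f i) y else 0) ≤
      M * ∑ s, ∑ x, ∑ y, μ x * w s x y *
        min 1 (M * Fintype.card T * classProb μ jt x y) := by
  set q := classProb μ jt with hq
  set κ : ℝ := M * Fintype.card T with hκ
  have hM : (0 : ℝ) ≤ M := Nat.cast_nonneg M
  have hq0 : ∀ x y, 0 ≤ q x y := fun x y =>
    sum_nonneg fun x' _ => by split_ifs <;> simp [hμ.1]
  have hκ0 : 0 ≤ κ := by positivity
  let A : α → ℝ := fun x => ∑ s, ∑ y, if κ * q x y < 1 then 0 else w s x y
  let B : α → α → ℝ := fun x x' => ∑ s, ∑ y,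
    (if κ * q x y < 1 then w s x y else 0) * if q x' y ≤ q x y then 1 else 0
  have hB0 : ∀ x x', 0 ≤ B x x' := fun x x' =>
    sum_nonneg fun s _ => sum_nonneg fun y _ => by split_ifs <;> simp [hw]
  have hprod : IsPMF fun f : Fin M → α => ∏ k, μ (f k) := by
    refine ⟨fun f => prod_nonneg fun k _ => hμ.1 _, ?_⟩
    have h := Finset.prod_univ_sum (fun _ : Fin M => (univ : Finset α)) (fun _ a => μ a)
    rw [Fintype.piFinset_univ] at h
    rw [← h]
    simp [hμ.2]
  have hB : ∀ x, ∑ x', μ x' * B x x' ≤ ∑ s, ∑ y,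
      (if κ * q x y < 1 then w s x y else 0) * (Fintype.card T * q x y) := by
    intro x
    simp only [B, mul_sum]
    rw [sum_comm]
    refine sum_le_sum fun s _ => ?_
    rw [sum_comm]
    refine sum_le_sum fun y _ => ?_
    have h0 : 0 ≤ (if κ * q x y < 1 then w s x y else 0) := by split_ifs <;> simp [hw]
    refine le_trans (le_of_eq ?_)
      (mul_le_mul_of_nonneg_left (sum_classProb_le μ hμ.1 jt x y) h0)
    rw [mul_sum]
    refine sum_congr rfl fun x' _ => ?_
    simp only [← hq]
    split_ifs <;> ring
  have hAB : ∀ x, A x + M * ∑ x', μ x' * B x x' ≤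
      ∑ s, ∑ y, w s x y * min 1 (κ * q x y) := by
    intro x
    refine le_trans (add_le_add le_rfl (mul_le_mul_of_nonneg_left (hB x) hM)) ?_
    simp only [A, mul_sum, ← sum_add_distrib]
    refine sum_le_sum fun s _ => sum_le_sum fun y _ => ?_
    split_ifs with h
    · rw [min_eq_right h.le, hκ]
      apply le_of_eq; ring
    · rw [min_eq_left (not_lt.1 h)]
      simp
  let c : (Fin M → α) → ℝ := fun f => ∑ i, (A (f i) + ∑ j ∈ univ.erase i, B (f i) (f j))
  have hc : ∑ f : Fin M → α, (∏ k, μ (f k)) * c f ≤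
      M * ∑ s, ∑ x, ∑ y, μ x * w s x y * min 1 (κ * q x y) := by
    have h1 : ∑ f : Fin M → α, (∏ k, μ (f k)) * c f =
        ∑ i : Fin M, (∑ x, μ x * A x + ∑ j ∈ univ.erase i, ∑ x, μ x * ∑ x', μ x' * B x x') := by
      simp only [c, mul_sum, mul_add]
      rw [sum_comm]
      refine sum_congr rfl fun i _ => ?_
      rw [sum_add_distrib, sum_prod_mul μ hμ.2 i A]
      congr 1
      rw [sum_comm]
      refine sum_congr rfl fun j hj => ?_
      rw [sum_prod_mul_pair μ hμ.2 (mem_erase.1 hj).1.symm B]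
      simp only [mul_sum]
    rw [h1]
    have h2 : ∀ i : Fin M,
        (∑ x, μ x * A x + ∑ j ∈ univ.erase i, ∑ x, μ x * ∑ x', μ x' * B x x') ≤
          ∑ s, ∑ x, ∑ y, μ x * w s x y * min 1 (κ * q x y) := by
      intro i
      have h3 : 0 ≤ ∑ x, μ x * ∑ x', μ x' * B x x' :=
        sum_nonneg fun x _ => mul_nonneg (hμ.1 x) (sum_nonneg fun x' _ =>
          mul_nonneg (hμ.1 x') (hB0 x x'))
      have h4 : ∑ j ∈ univ.erase i, ∑ x, μ x * ∑ x', μ x' * B x x' ≤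
          M * ∑ x, μ x * ∑ x', μ x' * B x x' := by
        rw [sum_const, nsmul_eq_mul]
        refine mul_le_mul_of_nonneg_right ?_ h3
        have := card_erase_le (s := (univ : Finset (Fin M))) (a := i)
        rw [card_univ, Fintype.card_fin] at this
        exact_mod_cast this
      calc _ ≤ ∑ x, μ x * A x + M * ∑ x, μ x * ∑ x', μ x' * B x x' := by gcongr
        _ = ∑ x, μ x * (A x + M * ∑ x', μ x' * B x x') := by
            rw [mul_sum, ← sum_add_distrib]
            exact sum_congr rfl fun x _ => by ring
        _ ≤ ∑ x, μ x * ∑ s, ∑ y, w s x y * min 1 (κ * q x y) :=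
            sum_le_sum fun x _ => mul_le_mul_of_nonneg_left (hAB x) (hμ.1 x)
        _ = _ := by
            rw [sum_comm]
            refine sum_congr rfl fun x _ => ?_
            simp only [mul_sum, mul_assoc]
    refine (sum_le_sum fun i _ => h2 i).trans ?_
    simp
  obtain ⟨f, hf, hfc⟩ := exists_pos_and_le_of_sum_le _ hprod c _ hc
  refine ⟨f, fun i => ?_, le_trans (sum_le_sum fun i _ => ?_) hfc⟩
  · refine (hμ.1 _).lt_of_ne fun h => hf.ne' ?_
    exact prod_eq_zero (mem_univ i) h.symm
  · simp only [A, B]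
    rw [sum_comm (s := univ.erase i), ← sum_add_distrib]
    refine sum_le_sum fun s _ => ?_
    rw [sum_comm (s := univ.erase i), ← sum_add_distrib]
    refine sum_le_sum fun y _ => ?_
    rw [← mul_sum]
    have hs0 : (0 : ℝ) ≤ ∑ j ∈ univ.erase i, if q (f j) y ≤ q (f i) y then (1 : ℝ) else 0 :=
      sum_nonneg fun j _ => by split_ifs <;> simp
    by_cases hlt : κ * q (f i) y < 1
    · simp only [hlt, if_true, zero_add]
      split_ifs with hj
      · obtain ⟨j, hji, hj⟩ := hj
        refine le_mul_of_one_le_right (hw _ _ _) ?_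
        refine le_trans ?_ (single_le_sum
          (f := fun j => if q (f j) y ≤ q (f i) y then (1 : ℝ) else 0)
          (fun j _ => by split_ifs <;> simp) (mem_erase.2 ⟨hji, mem_univ j⟩))
        simp [hj]
      · exact mul_nonneg (hw _ _ _) hs0
    · simp only [hlt, if_false, zero_mul, add_zero]
      split_ifs <;> simp [hw]

open Classical in
theorem exists_code {α β T S : Type} [Fintype α] [Fintype β] [Fintype T] [Fintype S]
    (μ : α → ℝ) (hμ : IsPMF μ) (w : S → α → β → ℝ) (hw : ∀ s x y, 0 ≤ w s x y)
    (jt : α → β → T) {M : ℕ} (hM : 0 < M) :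
    ∃ (f : Fin M → α) (h : β → Fin M), (∀ i, 0 < μ (f i)) ∧
      ∀ s i, ∑ y, (if h y ≠ i then w s (f i) y else 0) ≤
        2 * ∑ s, ∑ x, ∑ y, μ x * w s x y *
          min 1 ((2 * M : ℕ) * Fintype.card T * classProb μ jt x y) := by
  obtain ⟨f, hf, hc⟩ := exists_codebook μ hμ w hw jt (2 * M)
  have he0 : ∀ s i, 0 ≤ ∑ y, (if ∃ j, j ≠ i ∧
      classProb μ jt (f j) y ≤ classProb μ jt (f i) y then w s (f i) y else 0) :=
    fun s i => sum_nonneg fun y _ => by split_ifs <;> simp [hw]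
  obtain ⟨φ, hφ, hφe⟩ := exists_half_le _ (fun i => sum_nonneg fun s _ => he0 s i) _ hM hc
  have : Nonempty (Fin (2 * M)) := ⟨⟨0, by omega⟩⟩
  have hmin : ∀ y, ∃ j, ∀ i, classProb μ jt (f j) y ≤ classProb μ jt (f i) y := fun y =>
    Finite.exists_min fun i => classProb μ jt (f i) y
  choose h₀ hh₀ using hmin
  refine ⟨f ∘ φ, fun y => if hy : ∃ i, φ i = h₀ y then hy.choose else ⟨0, hM⟩,
    fun i => hf _, fun s i => ?_⟩
  refine le_trans (le_trans ?_ (single_le_sum (f := fun s => ∑ y, (if ∃ j, j ≠ φ i ∧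
      classProb μ jt (f j) y ≤ classProb μ jt (f (φ i)) y then w s (f (φ i)) y else 0))
      (fun s _ => he0 s (φ i)) (mem_univ s))) (hφe i)
  refine sum_le_sum fun y _ => ?_
  by_cases hy : h₀ y = φ i
  · have hy' : ∃ i, φ i = h₀ y := ⟨i, hy.symm⟩
    have : hy'.choose = i := hφ (hy'.choose_spec.trans hy)
    rw [if_neg]
    · split_ifs <;> simp [hw]
    · simp [hy', this]
  · rw [if_pos (⟨h₀ y, hy, hh₀ y _⟩ : ∃ j, j ≠ φ i ∧
      classProb μ jt (f j) y ≤ classProb μ jt (f (φ i)) y)]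
    split_ifs <;> simp [hw]

end RandomCoding

section Types

open Finset

theorem sum_prod_eq_one {Z : Type} [Fintype Z] {n : ℕ} {p : Z → ℝ} (hp : ∑ a, p a = 1) :
    ∑ z : Fin n → Z, ∏ i, p (z i) = 1 := by
  have h := Finset.prod_univ_sum (fun _ : Fin n => (univ : Finset Z)) (fun _ a => p a)
  rw [Fintype.piFinset_univ] at h
  rw [← h]
  simp [hp]

theorem prod_eq_exp_mul_prod {Z : Type} {n : ℕ} (z : Fin n → Z) (p u : Z → ℝ)
    (hp : ∀ i, 0 < p (z i))
    (hu : ∀ i, 0 < u (z i)) :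
    ∏ i, p (z i) =
      Real.exp (-∑ i, (Real.log (u (z i)) - Real.log (p (z i)))) * ∏ i, u (z i) := by
  rw [← sum_neg_distrib, Real.exp_sum, ← prod_mul_distrib]
  refine prod_congr rfl fun i _ => ?_
  rw [neg_sub, Real.exp_sub, Real.exp_log (hp i), Real.exp_log (hu i),
    div_mul_cancel₀ _ (hu i).ne']

variable {Z : Type} [Fintype Z] [DecidableEq Z] {n : ℕ}

theorem sum_eq_mul_sum_empDist (hn : 0 < n) (z : Fin n → Z) (φ : Z → ℝ) :
    ∑ i, φ (z i) = n * ∑ a, empDist z a * φ a := by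
  have hn' : (n : ℝ) ≠ 0 := by positivity
  rw [← sum_fiberwise univ z, mul_sum]
  refine sum_congr rfl fun a _ => ?_
  rw [sum_congr rfl (g := fun _ => φ a) fun i hi => by rw [(mem_filter.1 hi).2], sum_const,
    nsmul_eq_mul, empDist]
  field_simp

theorem empDist_isPMF (hn : 0 < n) (z : Fin n → Z) : IsPMF (empDist z) := by
  have hn' : (n : ℝ) ≠ 0 := by positivity
  refine ⟨fun a => by unfold empDist; positivity, ?_⟩
  have h := sum_eq_mul_sum_empDist hn z fun _ => 1
  simp only [sum_const, card_univ, Fintype.card_fin, nsmul_eq_mul, mul_one] at h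
  exact mul_left_cancel₀ hn' (by rw [← h, mul_one])

theorem empDist_pos (z : Fin n → Z) (i : Fin n) : 0 < empDist z (z i) := by
  have h1 : 0 < n := i.pos
  have h2 : 0 < (univ.filter fun j => z j = z i).card := card_pos.2 ⟨i, by simp⟩
  unfold empDist
  positivity

/-- The vector of letter counts of a sequence. -/
def letterCount (z : Fin n → Z) (a : Z) : Fin (n + 1) :=
  ⟨(univ.filter fun i => z i = a).card,
    Nat.lt_succ_of_le ((card_le_univ _).trans (Fintype.card_fin n).le)⟩

theorem empDist_eq_of_letterCount_eq {z z' : Fin n → Z} (h : letterCount z = letterCount z') :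
    empDist z = empDist z' := by
  funext a
  have := congrArg Fin.val (congrFun h a)
  simp only [letterCount] at this
  simp only [empDist, this]

theorem sum_prod_empDist_le (hn : 0 < n) :
    ∑ z : Fin n → Z, ∏ i, empDist z (z i) ≤ ((n : ℝ) + 1) ^ Fintype.card Z := by
  have hcard : ((n : ℝ) + 1) ^ Fintype.card Z = ∑ _c : Z → Fin (n + 1), (1 : ℝ) := by
    simp
  rw [hcard, ← sum_fiberwise univ (letterCount (n := n))]
  refine sum_le_sum fun c _ => ?_
  by_cases h : ∃ z₀ : Fin n → Z, letterCount z₀ = c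
  · obtain ⟨z₀, rfl⟩ := h
    have hz := empDist_isPMF hn z₀
    rw [← sum_prod_eq_one (n := n) hz.2, sum_filter]
    refine sum_le_sum fun z _ => ?_
    split_ifs with h
    · rw [empDist_eq_of_letterCount_eq h]
    · exact prod_nonneg fun i _ => hz.1 _
  · push Not at h
    rw [sum_eq_zero]
    · norm_num
    · intro z hz
      exact absurd (mem_filter.1 hz).2 (h z)

end Types

section Exponents

open Finset

variable [Fintype 𝒳] [Fintype 𝒴]

/-- Relative entropy of `t` with respect to `m`. -/
noncomputable def relEnt (m t : 𝒳 × 𝒴 → ℝ) : ℝ :=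
  ∑ z, (t z * Real.log (t z) - t z * Real.log (m z))

/-- Relative entropy of the joint distribution `t` with respect to the product of `P` and the
second marginal of `t`. -/
noncomputable def infoWith (P : 𝒳 → ℝ) (t : 𝒳 × 𝒴 → ℝ) : ℝ :=
  ∑ z, t z * Real.log (t z) - ∑ b, (∑ a, t (a, b)) * Real.log (∑ a, t (a, b))
    - ∑ z, t z * Real.log (P z.1)

/-- Squared distance of the first marginal of `t` from `P`. -/
noncomputable def margDev (P : 𝒳 → ℝ) (t : 𝒳 × 𝒴 → ℝ) : ℝ :=
  ∑ a, (∑ b, t (a, b) - P a) ^ 2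

/-- Joint distributions absolutely continuous with respect to `m`. -/
def acSet (m : 𝒳 × 𝒴 → ℝ) : Set (𝒳 × 𝒴 → ℝ) :=
  {t | IsPMF t ∧ ∀ z, m z = 0 → t z = 0}

/-- Joint-type exponent of a decoding error. -/
noncomputable def typeExp (P : 𝒳 → ℝ) (V : 𝒳 → 𝒴 → ℝ) (R : ℝ) (t : 𝒳 × 𝒴 → ℝ) : ℝ :=
  relEnt (fun z => P z.1 * V z.1 z.2) t + max (infoWith P t - R) 0

variable [DecidableEq 𝒳] [DecidableEq 𝒴] {n : ℕ}

theorem sum_empDist_snd (hn : 0 < n) (x : Fin n → 𝒳) (y : Fin n → 𝒴) (a : 𝒳) :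
    ∑ b, empDist (fun i => (x i, y i)) (a, b) = empDist x a := by
  have hn' : (n : ℝ) ≠ 0 := by positivity
  have h1 := sum_eq_mul_sum_empDist hn (fun i => (x i, y i)) fun z => if z.1 = a then 1 else 0
  have h2 := sum_eq_mul_sum_empDist hn x fun c => if c = a then 1 else 0
  simp only [Fintype.sum_prod_type, mul_ite, mul_one, mul_zero, sum_ite_eq', mem_univ, if_true]
    at h1 h2
  rw [h2] at h1
  rw [mul_left_cancel₀ hn' h1, sum_comm]
  simp

theorem margDev_empDist (hn : 0 < n) (P : 𝒳 → ℝ) (x : Fin n → 𝒳) (y : Fin n → 𝒴) :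
    margDev P (empDist fun i => (x i, y i)) = ∑ a, (empDist x a - P a) ^ 2 := by
  simp only [margDev, sum_empDist_snd hn]

theorem prod_le_exp_infoWith_mul {P : 𝒳 → ℝ} (hP : ∀ a, 0 ≤ P a) (hn : 0 < n)
    (x : Fin n → 𝒳) (y : Fin n → 𝒴) (t : 𝒳 × 𝒴 → ℝ) (ht : empDist (fun i => (x i, y i)) = t) :
    ∏ i, P (x i) ≤
      Real.exp (-(n * infoWith P t)) * ∏ i, (t (x i, y i) / ∑ a, t (a, y i)) := by
  have ht0 : IsPMF t := ht ▸ empDist_isPMF hn _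
  have htpos : ∀ i, 0 < t (x i, y i) := fun i => by
    rw [← ht]; exact empDist_pos (fun i => (x i, y i)) i
  have hYpos : ∀ i, 0 < ∑ a, t (a, y i) := fun i =>
    (htpos i).trans_le (single_le_sum (f := fun a => t (a, y i)) (fun a _ => ht0.1 _)
      (mem_univ (x i)))
  by_cases hpos : ∀ i, 0 < P (x i)
  · apply le_of_eq
    rw [prod_eq_exp_mul_prod (fun i => (x i, y i)) (fun z => P z.1)
      (fun z => t z / ∑ a, t (a, z.2)) hpos (fun i => div_pos (htpos i) (hYpos i))]
    congr 3
    have h1 : ∀ i, Real.log (t (x i, y i) / ∑ a, t (a, y i)) - Real.log (P (x i)) =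
        (fun z : 𝒳 × 𝒴 => Real.log (t z) - Real.log (∑ a, t (a, z.2)) - Real.log (P z.1))
          (x i, y i) := fun i => by
      simp only
      rw [Real.log_div (htpos i).ne' (hYpos i).ne']
    rw [sum_congr rfl fun i _ => h1 i, sum_eq_mul_sum_empDist hn (fun i => (x i, y i))
      (fun z : 𝒳 × 𝒴 => Real.log (t z) - Real.log (∑ a, t (a, z.2)) - Real.log (P z.1)), ht]
    congr 1
    simp only [infoWith, mul_sub, sum_sub_distrib]
    congr 2
    rw [Fintype.sum_prod_type, sum_comm]
    simp only [sum_mul]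
  · push Not at hpos
    obtain ⟨i, hi⟩ := hpos
    rw [prod_eq_zero (mem_univ i) (le_antisymm hi (hP _))]
    have := ht0.1
    exact mul_nonneg (Real.exp_pos _).le (prod_nonneg fun i _ =>
      div_nonneg (htpos i).le (hYpos i).le)

theorem classProb_le {P : 𝒳 → ℝ} (hP : ∀ a, 0 ≤ P a) (hn : 0 < n)
    (μ : (Fin n → 𝒳) → ℝ) {c : ℝ} (hμ : ∀ x, μ x ≤ c * ∏ i, P (x i)) (hc : 0 ≤ c)
    (x : Fin n → 𝒳) (y : Fin n → 𝒴) :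
    classProb μ (fun x y => letterCount fun i => (x i, y i)) x y ≤
      c * Real.exp (-(n * infoWith P (empDist fun i => (x i, y i)))) := by
  set t := empDist fun i => (x i, y i) with ht
  have ht0 : IsPMF t := empDist_isPMF hn _
  have hYpos : ∀ i, 0 < ∑ a, t (a, y i) := fun i =>
    (empDist_pos (fun i => (x i, y i)) i).trans_le
      (single_le_sum (f := fun a => t (a, y i)) (fun a _ => ht0.1 _) (mem_univ (x i)))
  have hsum : ∑ x' : Fin n → 𝒳, ∏ i, (t (x' i, y i) / ∑ a, t (a, y i)) = 1 := by
    have h := Finset.prod_univ_sum (fun _ : Fin n => (univ : Finset 𝒳))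
      (fun i a => t (a, y i) / ∑ a, t (a, y i))
    rw [Fintype.piFinset_univ] at h
    rw [← h]
    refine prod_eq_one fun i _ => ?_
    rw [← sum_div, div_self (hYpos i).ne']
  calc classProb μ (fun x y => letterCount fun i => (x i, y i)) x y
      ≤ ∑ x' : Fin n → 𝒳, c * Real.exp (-(n * infoWith P t)) *
          ∏ i, (t (x' i, y i) / ∑ a, t (a, y i)) := by
        refine sum_le_sum fun x' _ => ?_
        split_ifs with h
        · rw [mul_assoc]
          exact (hμ x').trans (mul_le_mul_of_nonneg_left
            (prod_le_exp_infoWith_mul hP hn x' y t (empDist_eq_of_letterCount_eq h)) hc)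
        · exact mul_nonneg (mul_nonneg hc (Real.exp_pos _).le)
            (prod_nonneg fun i _ => div_nonneg (ht0.1 _) (hYpos i).le)
    _ = c * Real.exp (-(n * infoWith P t)) := by rw [← mul_sum, hsum, mul_one]

theorem prod_mul_prod_eq_zero_or {P : 𝒳 → ℝ} (hP : ∀ a, 0 ≤ P a) {V : 𝒳 → 𝒴 → ℝ}
    (hV : ∀ a b, 0 ≤ V a b) (hn : 0 < n) (x : Fin n → 𝒳) (y : Fin n → 𝒴) (t : 𝒳 × 𝒴 → ℝ)
    (ht : empDist (fun i => (x i, y i)) = t) :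
    (∏ i, P (x i)) * ∏ i, V (x i) (y i) = 0 ∨
      t ∈ acSet (fun z => P z.1 * V z.1 z.2) ∧
      (∏ i, P (x i)) * ∏ i, V (x i) (y i) =
        Real.exp (-(n * relEnt (fun z => P z.1 * V z.1 z.2) t)) * ∏ i, t (x i, y i) := by
  rw [← prod_mul_distrib]
  by_cases hpos : ∀ i, 0 < P (x i) * V (x i) (y i)
  · right
    refine ⟨⟨ht ▸ empDist_isPMF hn _, fun z hz => ?_⟩, ?_⟩
    · rw [← ht, empDist, filter_false_of_mem]
      · simp
      · rintro i - rfl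
        exact (hpos i).ne' hz
    · rw [prod_eq_exp_mul_prod (fun i => (x i, y i)) (fun z => P z.1 * V z.1 z.2) t hpos
        fun i => ht ▸ empDist_pos (fun i => (x i, y i)) i]
      congr 3
      rw [sum_eq_mul_sum_empDist hn (fun i => (x i, y i))
        (fun z => Real.log (t z) - Real.log (P z.1 * V z.1 z.2)), ht]
      simp only [relEnt, mul_sub]
  · left
    push Not at hpos
    obtain ⟨i, hi⟩ := hpos
    exact prod_eq_zero (mem_univ i) (le_antisymm hi (mul_nonneg (hP _) (hV _ _)))

theorem mul_min_classProb_le {P : 𝒳 → ℝ} (hP : ∀ a, 0 ≤ P a) {V : 𝒳 → 𝒴 → ℝ}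
    (hV : ∀ a b, 0 ≤ V a b) (hn : 0 < n) {R e δ : ℝ}
    (hexp : ∀ t ∈ acSet (fun z : 𝒳 × 𝒴 => P z.1 * V z.1 z.2), margDev P t < δ →
      e ≤ typeExp P V R t)
    (μ : (Fin n → 𝒳) → ℝ) (hμ0 : ∀ x, 0 ≤ μ x) (hμ : ∀ x, μ x ≤ 2 * ∏ i, P (x i))
    (hμδ : ∀ x, μ x ≠ 0 → ∑ a, (empDist x a - P a) ^ 2 < δ) {M : ℕ}
    (hM : (M : ℝ) ≤ 4 * Real.exp (n * R)) {N : ℝ} (hN : 1 ≤ N)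
    (x : Fin n → 𝒳) (y : Fin n → 𝒴) :
    μ x * (∏ i, V (x i) (y i)) *
      min 1 (M * N * classProb μ (fun x y => letterCount fun i => (x i, y i)) x y) ≤
      16 * N * Real.exp (-(n * e)) * ∏ i, empDist (fun i => (x i, y i)) (x i, y i) := by
  have hVn : 0 ≤ ∏ i, V (x i) (y i) := prod_nonneg fun i _ => hV _ _
  have hq' := classProb_le hP hn μ hμ (by norm_num) x y
  have hq0 : 0 ≤ classProb μ (fun x y => letterCount fun i => (x i, y i)) x y :=
    sum_nonneg fun x' _ => by split_ifs <;> simp [hμ0]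
  have hdev := margDev_empDist hn P x y
  have hcases := prod_mul_prod_eq_zero_or hP hV hn x y _ rfl
  have hprodt : 0 ≤ ∏ i, empDist (fun i => (x i, y i)) (x i, y i) :=
    prod_nonneg fun i _ => (empDist_isPMF hn _).1 _
  generalize classProb μ (fun x y => letterCount fun i => (x i, y i)) x y = q at *
  generalize (empDist fun i => (x i, y i)) = t at *
  generalize (∏ i, t (x i, y i)) = u at *
  have hrhs : 0 ≤ 16 * N * Real.exp (-(n * e)) * u := by positivity
  by_cases hx : μ x = 0
  · simpa [hx] using hrhs
  have hmin : min 1 (M * N * q) ≤ 8 * N * Real.exp (-(n * max (infoWith P t - R) 0)) := by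
    rcases le_total (infoWith P t - R) 0 with h | h
    · rw [max_eq_right h]
      refine (min_le_left _ _).trans ?_
      simp
      linarith
    · rw [max_eq_left h]
      refine (min_le_right _ _).trans ?_
      calc M * N * q ≤ 4 * Real.exp (n * R) * N * (2 * Real.exp (-(n * infoWith P t))) :=
            mul_le_mul (mul_le_mul_of_nonneg_right hM (by linarith)) hq' hq0 (by positivity)
        _ = 8 * N * (Real.exp (n * R) * Real.exp (-(n * infoWith P t))) := by ring
        _ = _ := by rw [← Real.exp_add]; ring_nf
  have hmin0 : 0 ≤ min 1 (M * N * q) := by positivity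
  have hμV : μ x * (∏ i, V (x i) (y i)) ≤ 2 * ((∏ i, P (x i)) * ∏ i, V (x i) (y i)) := by
    rw [← mul_assoc]
    exact mul_le_mul_of_nonneg_right (hμ x) hVn
  rcases hcases with h0 | ⟨hac, hprod⟩
  · rw [h0, mul_zero] at hμV
    exact (mul_nonpos_of_nonpos_of_nonneg hμV hmin0).trans hrhs
  · have hF := hexp t hac (hdev ▸ hμδ x hx)
    rw [hprod] at hμV
    calc _ ≤ 2 * (Real.exp (-(n * relEnt (fun z => P z.1 * V z.1 z.2) t)) * u) *
          (8 * N * Real.exp (-(n * max (infoWith P t - R) 0))) :=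
          mul_le_mul hμV hmin hmin0 (by positivity)
      _ = 16 * N * (Real.exp (-(n * relEnt (fun z => P z.1 * V z.1 z.2) t)) *
          Real.exp (-(n * max (infoWith P t - R) 0))) * u := by ring
      _ = 16 * N * Real.exp (-(n * typeExp P V R t)) * u := by
          rw [← Real.exp_add, typeExp]; ring_nf
      _ ≤ _ := by gcongr

theorem sum_sum_prod_empDist_le (hn : 0 < n) :
    ∑ x : Fin n → 𝒳, ∑ y : Fin n → 𝒴, ∏ i, empDist (fun i => (x i, y i)) (x i, y i) ≤
      ((n : ℝ) + 1) ^ Fintype.card (𝒳 × 𝒴) := by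
  refine le_trans (le_of_eq ?_) (sum_prod_empDist_le (Z := 𝒳 × 𝒴) hn)
  rw [← Fintype.sum_prod_type']
  exact Fintype.sum_equiv (Equiv.arrowProdEquivProdArrow (Fin n) (fun _ => 𝒳)
    (fun _ => 𝒴)).symm _ _ fun z => rfl

theorem decoding_bound {P : 𝒳 → ℝ} (hP : ∀ a, 0 ≤ P a) {V : 𝒳 → 𝒴 → ℝ}
    (hV : ∀ a b, 0 ≤ V a b) (hn : 0 < n) {R e δ : ℝ}
    (hexp : ∀ t ∈ acSet (fun z : 𝒳 × 𝒴 => P z.1 * V z.1 z.2), margDev P t < δ →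
      e ≤ typeExp P V R t)
    (μ : (Fin n → 𝒳) → ℝ) (hμ0 : ∀ x, 0 ≤ μ x) (hμ : ∀ x, μ x ≤ 2 * ∏ i, P (x i))
    (hμδ : ∀ x, μ x ≠ 0 → ∑ a, (empDist x a - P a) ^ 2 < δ) {M : ℕ}
    (hM : (M : ℝ) ≤ 4 * Real.exp (n * R)) :
    ∑ x, ∑ y : Fin n → 𝒴, μ x * (∏ i, V (x i) (y i)) *
      min 1 (M * Fintype.card (𝒳 × 𝒴 → Fin (n + 1)) *
        classProb μ (fun x y => letterCount fun i => (x i, y i)) x y) ≤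
      16 * (((n : ℝ) + 1) ^ Fintype.card (𝒳 × 𝒴)) ^ 2 * Real.exp (-(n * e)) := by
  have hcard : (Fintype.card (𝒳 × 𝒴 → Fin (n + 1)) : ℝ) =
      ((n : ℝ) + 1) ^ Fintype.card (𝒳 × 𝒴) := by
    rw [Fintype.card_fun, Fintype.card_fin]; push_cast; rfl
  have hN : 1 ≤ ((n : ℝ) + 1) ^ Fintype.card (𝒳 × 𝒴) :=
    one_le_pow₀ (by linarith [(Nat.cast_nonneg n : (0 : ℝ) ≤ n)])
  have hsum := sum_sum_prod_empDist_le (𝒳 := 𝒳) (𝒴 := 𝒴) hn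
  rw [hcard]
  generalize ((n : ℝ) + 1) ^ Fintype.card (𝒳 × 𝒴) = N at *
  refine (sum_le_sum fun x _ => sum_le_sum fun y _ =>
    mul_min_classProb_le hP hV hn hexp μ hμ0 hμ hμδ hM hN x y).trans ?_
  simp only [← mul_sum]
  refine (mul_le_mul_of_nonneg_left hsum (by positivity)).trans (le_of_eq ?_)
  ring

end Exponents

section Compactness

open Finset Filter Topology

theorem eventually_add_le_of_isCompact {X : Type} [TopologicalSpace X] {K : Set X}
    (hK : IsCompact K) {F g : X → ℝ} (hF : Continuous F) (hg : Continuous g)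
    (hg0 : ∀ t, 0 ≤ g t) {c : ℝ} (h : ∀ t ∈ K, g t = 0 → c < F t) :
    ∀ᶠ m in 𝓝[>] (0 : ℝ), ∀ t ∈ K, g t < m → c + m ≤ F t := by
  rcases K.eq_empty_or_nonempty with rfl | hne
  · simp
  obtain ⟨t₀, ht₀, hmin⟩ := hK.exists_isMinOn hne
    (f := fun t => max (F t - c) (g t)) (by fun_prop)
  have hpos : 0 < max (F t₀ - c) (g t₀) := by
    rcases (hg0 t₀).eq_or_lt with h0 | h0
    · exact lt_max_of_lt_left (sub_pos.2 (h t₀ ht₀ h0.symm))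
    · exact lt_max_of_lt_right h0
  filter_upwards [Ioo_mem_nhdsGT hpos] with m hm t ht hgt
  have h1 : max (F t₀ - c) (g t₀) ≤ max (F t - c) (g t) := hmin ht
  rcases le_max_iff.1 h1 with h2 | h2
  · linarith [hm.2]
  · linarith [hm.2]

variable [Fintype 𝒳] [Fintype 𝒴]

theorem isCompact_setOf_isPMF : IsCompact {p : 𝒳 → ℝ | IsPMF p} :=
  isCompact_stdSimplex ℝ 𝒳

theorem isCompact_acSet (m : 𝒳 × 𝒴 → ℝ) : IsCompact (acSet m) := by
  refine (isCompact_setOf_isPMF (𝒳 := 𝒳 × 𝒴)).inter_right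
    (t := {t : 𝒳 × 𝒴 → ℝ | ∀ z, m z = 0 → t z = 0}) ?_
  simp only [Set.ofPred_forall]
  exact isClosed_iInter fun z => isClosed_iInter fun _ =>
    isClosed_eq (continuous_apply z) continuous_const

theorem continuous_typeExp (P : 𝒳 → ℝ) (V : 𝒳 → 𝒴 → ℝ) (R : ℝ) :
    Continuous (typeExp P V R) := by
  have h := Real.continuous_mul_log
  have h1 : ∀ z : 𝒳 × 𝒴, Continuous fun t : 𝒳 × 𝒴 → ℝ => t z * Real.log (t z) :=
    fun z => h.comp (continuous_apply z)
  have h2 : ∀ b : 𝒴, Continuous fun t : 𝒳 × 𝒴 → ℝ =>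
      (∑ a, t (a, b)) * Real.log (∑ a, t (a, b)) :=
    fun b => h.comp (continuous_finsetSum _ fun a _ => continuous_apply (a, b))
  unfold typeExp relEnt infoWith
  fun_prop

theorem continuous_margDev (P : 𝒳 → ℝ) : Continuous (margDev (𝒴 := 𝒴) P) := by
  unfold margDev
  fun_prop

theorem margDev_nonneg (P : 𝒳 → ℝ) (t : 𝒳 × 𝒴 → ℝ) : 0 ≤ margDev P t :=
  sum_nonneg fun _ _ => sq_nonneg _

theorem margDev_eq_zero {P : 𝒳 → ℝ} {t : 𝒳 × 𝒴 → ℝ} (h : margDev P t = 0) (a : 𝒳) :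
    ∑ b, t (a, b) = P a := by
  have := (sum_eq_zero_iff_of_nonneg fun _ _ => sq_nonneg _).1 h a (mem_univ a)
  exact sub_eq_zero.1 (pow_eq_zero_iff two_ne_zero |>.1 this)

theorem relEnt_eq_sum_klFun {m t : 𝒳 × 𝒴 → ℝ} (hm : IsPMF m) (ht : t ∈ acSet m) :
    relEnt m t = ∑ z, m z * InformationTheory.klFun (t z / m z) := by
  have h : ∀ z, m z * InformationTheory.klFun (t z / m z) =
      t z * Real.log (t z) - t z * Real.log (m z) + m z - t z := by
    intro z
    rcases (hm.1 z).eq_or_lt with h0 | h0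
    · simp [← h0, ht.2 z h0.symm]
    rcases (ht.1.1 z).eq_or_lt with h1 | h1
    · simp [← h1, InformationTheory.klFun]
    rw [InformationTheory.klFun, Real.log_div h1.ne' h0.ne']
    field_simp
  simp only [h, sum_sub_distrib, sum_add_distrib, hm.2, ht.1.2, relEnt]
  ring

theorem relEnt_nonneg {m t : 𝒳 × 𝒴 → ℝ} (hm : IsPMF m) (ht : t ∈ acSet m) :
    0 ≤ relEnt m t := by
  rw [relEnt_eq_sum_klFun hm ht]
  exact sum_nonneg fun z _ => mul_nonneg (hm.1 z)
    (InformationTheory.klFun_nonneg (div_nonneg (ht.1.1 z) (hm.1 z)))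

theorem eq_of_relEnt_eq_zero {m t : 𝒳 × 𝒴 → ℝ} (hm : IsPMF m) (ht : t ∈ acSet m)
    (h : relEnt m t = 0) : t = m := by
  rw [relEnt_eq_sum_klFun hm ht, sum_eq_zero_iff_of_nonneg fun z _ => mul_nonneg (hm.1 z)
    (InformationTheory.klFun_nonneg (div_nonneg (ht.1.1 z) (hm.1 z)))] at h
  funext z
  by_cases h0 : m z = 0
  · rw [h0, ht.2 z h0]
  · have := (mul_eq_zero.1 (h z (mem_univ z))).resolve_left h0
    rw [InformationTheory.klFun_eq_zero_iff (div_nonneg (ht.1.1 z) (hm.1 z))] at this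
    exact (div_eq_one_iff_eq h0).1 this

theorem isPMF_joint {P : 𝒳 → ℝ} (hP : IsPMF P) {V : 𝒳 → 𝒴 → ℝ} (hV : IsChannel V) :
    IsPMF fun z : 𝒳 × 𝒴 => P z.1 * V z.1 z.2 := by
  refine ⟨fun z => mul_nonneg (hP.1 _) ((hV _).1 _), ?_⟩
  rw [Fintype.sum_prod_type]
  simp only [← mul_sum, (hV _).2, mul_one, hP.2]

theorem infoWith_joint {P : 𝒳 → ℝ} (hP : IsPMF P) {Q : 𝒳 → 𝒴 → ℝ} (hQ : IsChannel Q) :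
    infoWith P (fun z => P z.1 * Q z.1 z.2) = mutualInfo P Q := by
  have h : ∀ a b, P a * Q a b * Real.log (Q a b / ∑ x', P x' * Q x' b) =
      P a * Q a b * Real.log (P a * Q a b) -
        P a * Q a b * Real.log (∑ x', P x' * Q x' b) - P a * Q a b * Real.log (P a) := by
    intro a b
    by_cases h0 : P a * Q a b = 0
    · simp [h0]
    have h1 := left_ne_zero_of_mul h0
    have h2 := right_ne_zero_of_mul h0
    have h3 : 0 < P a * Q a b := (mul_nonneg (hP.1 a) ((hQ a).1 b)).lt_of_ne' h0
    have h4 : 0 < ∑ x', P x' * Q x' b := h3.trans_le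
      (single_le_sum (f := fun x' => P x' * Q x' b)
        (fun x' _ => mul_nonneg (hP.1 x') ((hQ x').1 b)) (mem_univ a))
    rw [Real.log_div h2 h4.ne', Real.log_mul h1 h2]
    ring
  simp only [mutualInfo, h, sum_sub_distrib, infoWith, Fintype.sum_prod_type]
  congr 2
  rw [sum_comm (f := fun a b => P a * Q a b * Real.log (∑ x', P x' * Q x' b))]
  simp only [sum_mul]

theorem relEnt_joint {P : 𝒳 → ℝ} {Q V : 𝒳 → 𝒴 → ℝ}
    (hac : ∀ x y, P x * Q x y ≠ 0 → V x y ≠ 0) :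
    relEnt (fun z => P z.1 * V z.1 z.2) (fun z => P z.1 * Q z.1 z.2) =
      ∑ x, ∑ y, P x * Q x y * Real.log (Q x y / V x y) := by
  rw [relEnt, Fintype.sum_prod_type]
  refine sum_congr rfl fun a _ => sum_congr rfl fun b _ => ?_
  by_cases h0 : P a * Q a b = 0
  · simp [h0]
  have h1 := left_ne_zero_of_mul h0
  have h2 := right_ne_zero_of_mul h0
  have h3 := hac a b h0
  simp only
  rw [Real.log_div h2 h3, Real.log_mul h1 h2, Real.log_mul h1 h3]
  ring

theorem exists_channel_of_margDev_eq_zero {P : 𝒳 → ℝ} (hP : IsPMF P) {V : 𝒳 → 𝒴 → ℝ}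
    (hV : IsChannel V) {t : 𝒳 × 𝒴 → ℝ} (ht : IsPMF t) (h : margDev P t = 0) :
    ∃ Q : 𝒳 → 𝒴 → ℝ, IsChannel Q ∧ t = fun z => P z.1 * Q z.1 z.2 := by
  refine ⟨fun a b => if P a = 0 then V a b else t (a, b) / P a, fun a => ?_, ?_⟩
  · by_cases ha : P a = 0
    · simpa only [ha, if_true] using hV a
    · simp only [ha, if_false]
      refine ⟨fun b => div_nonneg (ht.1 _) (hP.1 a), ?_⟩
      rw [← sum_div, margDev_eq_zero h a, div_self ha]
  · funext ⟨a, b⟩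
    by_cases ha : P a = 0
    · have := margDev_eq_zero h a
      rw [ha, sum_eq_zero_iff_of_nonneg fun b _ => ht.1 _] at this
      simp [ha, this b (mem_univ b)]
    · simp only [ha, if_false]
      field_simp

theorem lt_typeExp {W : 𝒮 → 𝒳 → 𝒴 → ℝ} (hW : ∀ s, IsChannel (W s)) {P : 𝒳 → ℝ}
    (hP : IsPMF P) {R R' E c : ℝ} (hR : ∀ s, R ≤ mutualInfo P (W s)) (hR' : R' < R)
    (hE : ENNReal.ofReal E ≤ rhoSucc W P R) (hc : 0 < c → c < E) (s : 𝒮) {t : 𝒳 × 𝒴 → ℝ}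
    (ht : t ∈ acSet fun z : 𝒳 × 𝒴 => P z.1 * W s z.1 z.2) (h : margDev P t = 0) :
    c < typeExp P (W s) R' t := by
  have hm := isPMF_joint hP (hW s)
  have hD := relEnt_nonneg hm ht
  have hpos : 0 < typeExp P (W s) R' t := by
    by_contra! hle
    have hI := le_max_right (infoWith P t - R') 0
    have hI' := le_max_left (infoWith P t - R') 0
    have hle' : relEnt (fun z => P z.1 * W s z.1 z.2) t + max (infoWith P t - R') 0 ≤ 0 := hle
    have ht' := eq_of_relEnt_eq_zero hm ht (by linarith)
    have hI2 : infoWith P t = mutualInfo P (W s) := by rw [ht', infoWith_joint hP (hW s)]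
    linarith [hR s]
  rcases le_or_gt c 0 with hc0 | hc0
  · exact hc0.trans_lt hpos
  refine (hc hc0).trans_le ?_
  obtain ⟨Q, hQ, rfl⟩ := exists_channel_of_margDev_eq_zero hP (hW s) ht.1 h
  have hac : ∀ x y, P x * Q x y ≠ 0 → W s x y ≠ 0 := fun x y hxy hz =>
    hxy (ht.2 (x, y) (by simp [hz]))
  have h1 : ENNReal.ofReal E ≤ condKL P Q (W s) + ENNReal.ofReal (mutualInfo P Q - R) :=
    hE.trans ((iInf_le _ s).trans (iInf₂_le Q hQ))
  rw [condKL, if_pos hac, ← relEnt_joint hac] at h1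
  have h2 : ENNReal.ofReal (mutualInfo P Q - R) ≤
      ENNReal.ofReal (max (infoWith P (fun z => P z.1 * Q z.1 z.2) - R') 0) := by
    refine ENNReal.ofReal_le_ofReal ?_
    rw [infoWith_joint hP hQ]
    exact le_max_of_le_left (by linarith)
  have h3 := h1.trans (add_le_add le_rfl h2)
  rw [← ENNReal.ofReal_add hD (le_max_right _ _)] at h3
  exact (ENNReal.ofReal_le_ofReal_iff (add_nonneg hD (le_max_right _ _))).1 h3

end Compactness

section Typical

open Finset

variable [Fintype 𝒳] [DecidableEq 𝒳] {n : ℕ}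

theorem sum_prod_mul_empDist_sq_le {P : 𝒳 → ℝ} (hP : IsPMF P) (hn : 0 < n) :
    ∑ x : Fin n → 𝒳, (∏ i, P (x i)) * ∑ a, (empDist x a - P a) ^ 2 ≤ 1 / n := by
  have hn' : (0 : ℝ) < n := by positivity
  let φ : 𝒳 → 𝒳 → ℝ := fun a c => (if c = a then 1 else 0) - P a
  have hφ : ∀ a, ∑ c, P c * φ a c = 0 := fun a => by
    simp [φ, mul_sub, sum_sub_distrib, ← sum_mul, hP.2]
  have hemp : ∀ (x : Fin n → 𝒳) a, empDist x a - P a = (∑ i, φ a (x i)) / n := fun x a => by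
    rw [sum_eq_mul_sum_empDist hn x (φ a), mul_div_cancel_left₀ _ hn'.ne']
    simp [φ, mul_sub, sum_sub_distrib, ← sum_mul, (empDist_isPMF hn x).2]
  have hvar : ∀ a, ∑ x : Fin n → 𝒳, (∏ i, P (x i)) * (empDist x a - P a) ^ 2 =
      (∑ c, P c * φ a c ^ 2) / n := by
    intro a
    have h1 : ∀ x : Fin n → 𝒳, (∏ i, P (x i)) * (empDist x a - P a) ^ 2 =
        (∑ i, ∑ j, (∏ i, P (x i)) * (φ a (x i) * φ a (x j))) / n ^ 2 := fun x => by
      simp only [← mul_sum, ← sum_mul]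
      rw [hemp x a]
      ring
    simp only [h1]
    rw [← sum_div, sum_comm]
    have h2 : ∀ i : Fin n, ∑ x : Fin n → 𝒳, ∑ j, (∏ i, P (x i)) * (φ a (x i) * φ a (x j)) =
        ∑ c, P c * φ a c ^ 2 := by
      intro i
      rw [sum_comm, sum_eq_single i]
      · simp only [← sq]
        exact sum_prod_mul P hP.2 i fun c => φ a c ^ 2
      · intro j _ hj
        rw [sum_prod_mul_mul P hP.2 hj.symm, hφ, zero_mul]
      · simp
    rw [sum_congr rfl fun i _ => h2 i, sum_const, card_univ, Fintype.card_fin, nsmul_eq_mul]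
    field_simp
  have hbound : ∀ a, ∑ c, P c * φ a c ^ 2 ≤ P a := fun a => by
    have h1 : ∀ c, P c * φ a c ^ 2 =
        (if c = a then P c else 0) - 2 * P a * (if c = a then P c else 0) + P c * P a ^ 2 := by
      intro c
      simp only [φ]
      split_ifs <;> ring
    simp only [h1, sum_add_distrib, sum_sub_distrib, ← mul_sum, ← sum_mul, hP.2, sum_ite_eq',
      mem_univ, if_true]
    nlinarith [sq_nonneg (P a)]
  simp only [mul_sum]
  rw [sum_comm, sum_congr rfl fun a _ => hvar a, ← sum_div]
  gcongr
  exact (sum_le_sum fun a _ => hbound a).trans hP.2.le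

theorem exists_typical_pmf {P : 𝒳 → ℝ} (hP : IsPMF P) (hn : 0 < n) {δ : ℝ}
    (hδ : 2 ≤ n * δ) :
    ∃ μ : (Fin n → 𝒳) → ℝ, IsPMF μ ∧ (∀ x, μ x ≤ 2 * ∏ i, P (x i)) ∧
      ∀ x, μ x ≠ 0 → ∑ a, (empDist x a - P a) ^ 2 < δ := by
  classical
  have hn' : (0 : ℝ) < n := by positivity
  have hδ0 : 0 < δ := by
    by_contra! h
    nlinarith
  set p : (Fin n → 𝒳) → ℝ := fun x => ∏ i, P (x i) with hp
  set d : (Fin n → 𝒳) → ℝ := fun x => ∑ a, (empDist x a - P a) ^ 2 with hd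
  have hp0 : ∀ x, 0 ≤ p x := fun x => prod_nonneg fun i _ => hP.1 _
  have hd0 : ∀ x, 0 ≤ d x := fun x => sum_nonneg fun a _ => sq_nonneg _
  set Z : ℝ := ∑ x, if d x < δ then p x else 0 with hZ
  have hZ2 : 1 / 2 ≤ Z := by
    have h1 : ∑ x, p x = 1 := sum_prod_eq_one hP.2
    have h2 : ∑ x, p x ≤ Z + (∑ x, p x * d x) / δ := by
      rw [hZ, sum_div, ← sum_add_distrib]
      refine sum_le_sum fun x _ => ?_
      split_ifs with h
      · exact le_add_of_nonneg_right (div_nonneg (mul_nonneg (hp0 x) (hd0 x)) hδ0.le)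
      · rw [zero_add, le_div_iff₀ hδ0]
        exact mul_le_mul_of_nonneg_left (not_lt.1 h) (hp0 x)
    have h3 : (∑ x, p x * d x) / δ ≤ 1 / 2 := by
      rw [div_le_iff₀ hδ0]
      refine (sum_prod_mul_empDist_sq_le hP hn).trans ?_
      rw [div_le_iff₀ hn']
      linarith
    linarith
  have hZ0 : 0 < Z := by linarith
  refine ⟨fun x => (if d x < δ then p x else 0) / Z, ⟨fun x => ?_, ?_⟩, fun x => ?_,
    fun x hx => ?_⟩
  · refine div_nonneg ?_ hZ0.le
    split_ifs
    · exact hp0 x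
    · exact le_rfl
  · rw [← sum_div, div_self hZ0.ne']
  · rw [div_le_iff₀ hZ0]
    have := hp0 x
    split_ifs
    · change p x ≤ 2 * p x * Z
      nlinarith
    · exact mul_nonneg (mul_nonneg two_pos.le this) hZ0.le
  · by_contra h
    refine hx ?_
    change (if d x < δ then p x else 0) / Z = 0
    rw [if_neg h, zero_div]

end Typical

section Detection

open Finset

theorem prod_le_prod_pow0 {ι : Type} [Fintype ι] {a b : ι → ℝ} (ha : ∀ i, 0 ≤ a i)
    (hb : ∀ i, 0 ≤ b i) (h : ∏ i, a i ≤ ∏ i, b i) {ℓ : ℝ} (hℓ : ℓ ∈ Set.Icc (0 : ℝ) 1) :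
    ∏ i, a i ≤ ∏ i, pow0 (a i) ℓ * pow0 (b i) (1 - ℓ) := by
  have hpow : ∀ c r : ℝ, 0 ≤ c → 0 ≤ pow0 c r := fun c r hc => by
    unfold pow0
    split_ifs
    · exact le_rfl
    · exact Real.rpow_nonneg hc r
  rcases (prod_nonneg fun i _ => ha i : 0 ≤ ∏ i, a i).eq_or_lt with h0 | h0
  · rw [← h0]
    exact prod_nonneg fun i _ => mul_nonneg (hpow _ _ (ha i)) (hpow _ _ (hb i))
  have ha' : ∀ i, a i ≠ 0 := fun i => prod_ne_zero_iff.1 h0.ne' i (mem_univ i)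
  have hb' : ∀ i, b i ≠ 0 := fun i => prod_ne_zero_iff.1 (h0.trans_le h).ne' i (mem_univ i)
  simp only [pow0, ha', hb', if_false, prod_mul_distrib]
  rw [Real.finsetProd_rpow _ _ fun i _ => ha i, Real.finsetProd_rpow _ _ fun i _ => hb i]
  calc ∏ i, a i = (∏ i, a i) ^ ℓ * (∏ i, a i) ^ (1 - ℓ) := by
        rw [← Real.rpow_add h0]; simp
    _ ≤ _ := mul_le_mul_of_nonneg_left
        (Real.rpow_le_rpow h0.le h (by linarith [hℓ.2])) (Real.rpow_nonneg h0.le _)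

open Classical in
theorem detection_pair_bound [Fintype 𝒳] [DecidableEq 𝒳] [Fintype 𝒴] {V V' : 𝒳 → 𝒴 → ℝ}
    (hV : ∀ a b, 0 ≤ V a b) (hV' : ∀ a b, 0 ≤ V' a b) {n : ℕ} (hn : 0 < n) (x : Fin n → 𝒳)
    {ℓ c : ℝ} (hℓ : ℓ ∈ Set.Icc (0 : ℝ) 1)
    (hc : c ≤ -∑ a, empDist x a * Real.log (chernoffSum (V a) (V' a) ℓ)) :
    ∑ y : Fin n → 𝒴, (if ∏ i, V (x i) (y i) ≤ ∏ i, V' (x i) (y i)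
      then ∏ i, V (x i) (y i) else 0) ≤ Real.exp (-(n * c)) := by
  have hpow : ∀ c r : ℝ, 0 ≤ c → 0 ≤ pow0 c r := fun c r hc => by
    unfold pow0
    split_ifs
    · exact le_rfl
    · exact Real.rpow_nonneg hc r
  calc _ ≤ ∑ y : Fin n → 𝒴, ∏ i, pow0 (V (x i) (y i)) ℓ * pow0 (V' (x i) (y i)) (1 - ℓ) := by
        refine sum_le_sum fun y _ => ?_
        split_ifs with h
        · exact prod_le_prod_pow0 (fun i => hV _ _) (fun i => hV' _ _) h hℓ
        · exact prod_nonneg fun i _ => mul_nonneg (hpow _ _ (hV _ _)) (hpow _ _ (hV' _ _))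
    _ = ∏ i, chernoffSum (V (x i)) (V' (x i)) ℓ := by
        have h := Finset.prod_univ_sum (fun _ : Fin n => (univ : Finset 𝒴))
          (fun i b => pow0 (V (x i) b) ℓ * pow0 (V' (x i) b) (1 - ℓ))
        rw [Fintype.piFinset_univ] at h
        rw [← h]
        rfl
    _ ≤ ∏ i, Real.exp (Real.log (chernoffSum (V (x i)) (V' (x i)) ℓ)) :=
        prod_le_prod (fun i _ => sum_nonneg fun y _ =>
          mul_nonneg (hpow _ _ (hV _ _)) (hpow _ _ (hV' _ _))) fun i _ => Real.le_exp_log _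
    _ = Real.exp (n * ∑ a, empDist x a * Real.log (chernoffSum (V a) (V' a) ℓ)) := by
        rw [← Real.exp_sum, sum_eq_mul_sum_empDist hn x
          fun a => Real.log (chernoffSum (V a) (V' a) ℓ)]
    _ ≤ _ := by
        refine Real.exp_le_exp.2 ?_
        rw [← mul_neg]
        exact mul_le_mul_of_nonneg_left (by linarith) (Nat.cast_nonneg n)

theorem exists_chernoff_gt [Fintype 𝒳] [Fintype 𝒴] [Fintype 𝒮] {W : 𝒮 → 𝒳 → 𝒴 → ℝ}
    {P : 𝒳 → ℝ} {c : ℝ} (hc : c < phi W P) {s s' : 𝒮} (hs : s' ≠ s) :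
    ∃ ℓ ∈ Set.Icc (0 : ℝ) 1,
      c < -∑ a, P a * Real.log (chernoffSum (W s a) (W s' a) ℓ) := by
  have h1 : phi W P ≤ psi W P s := ciInf_le (Set.finite_range _).bddBelow s
  have h2 : psi W P s ≤ chernoffPair P (W s) (W s') :=
    csInf_le ((Set.toFinite _).image _).bddBelow ⟨s', hs, rfl⟩
  obtain ⟨_, ⟨ℓ, hℓ, rfl⟩, h⟩ := exists_lt_of_lt_csSup
    ((Set.nonempty_Icc.2 zero_le_one).image _) (hc.trans_le (h1.trans h2))
  exact ⟨ℓ, hℓ, h⟩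

open Classical in
theorem exists_detector [Fintype 𝒴] [Fintype 𝒮] [Nonempty 𝒮] (W : 𝒮 → 𝒳 → 𝒴 → ℝ)
    (hW : ∀ s a b, 0 ≤ W s a b) {n M : ℕ} (f : Fin M → Fin n → 𝒳)
    (h : (Fin n → 𝒴) → Fin M) :
    ∃ g : (Fin n → 𝒴) → 𝒮, ∀ s i, biProbEvent W (f i) s (fun y => g y ≠ s) ≤
      biProbEvent W (f i) s (fun y => h y ≠ i) +
        ∑ s' ∈ univ.erase s, ∑ y : Fin n → 𝒴,
          if ∏ k, W s (f i k) (y k) ≤ ∏ k, W s' (f i k) (y k)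
            then ∏ k, W s (f i k) (y k) else 0 := by
  have hmax : ∀ y : Fin n → 𝒴, ∃ s, ∀ s', ∏ k, W s' (f (h y) k) (y k) ≤
      ∏ k, W s (f (h y) k) (y k) := fun y =>
    Finite.exists_max fun s => ∏ k, W s (f (h y) k) (y k)
  choose g hg using hmax
  refine ⟨g, fun s i => ?_⟩
  rw [sum_comm]
  unfold biProbEvent
  rw [← sum_add_distrib]
  refine sum_le_sum fun y _ => ?_
  have h0 : 0 ≤ ∏ k, W s (f i k) (y k) := prod_nonneg fun k _ => hW _ _ _
  have h1 : ∀ s' ∈ univ.erase s, 0 ≤ if ∏ k, W s (f i k) (y k) ≤ ∏ k, W s' (f i k) (y k)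
      then ∏ k, W s (f i k) (y k) else 0 := fun s' _ => by
    split_ifs
    · exact h0
    · exact le_rfl
  by_cases hy : h y = i
  · rw [if_neg (c := h y ≠ i) (by simpa using hy), zero_add]
    split_ifs with hgs
    · refine le_trans ?_ (single_le_sum h1 (mem_erase.2 ⟨hgs, mem_univ (g y)⟩))
      rw [if_pos]
      have := hg y s
      rwa [hy] at this
    · exact sum_nonneg h1
  · rw [if_pos (c := h y ≠ i) hy]
    refine le_add_of_le_of_nonneg ?_ (sum_nonneg h1)
    split_ifs
    · exact le_rfl
    · exact h0

end Detection

section Asymptotics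

open Filter Topology

theorem eventually_mul_pow_mul_exp_le (A : ℝ) (j : ℕ) {b ε : ℝ} (hb : 0 < b) (hε : 0 < ε) :
    ∀ᶠ n : ℕ in atTop, A * ((n : ℝ) + 1) ^ j * Real.exp (-(n * b)) ≤ ε := by
  have hr : |Real.exp (-b)| < 1 := by
    rw [abs_of_pos (Real.exp_pos _)]
    simpa using hb
  have h := (((tendsto_pow_const_mul_const_pow_of_abs_lt_one j hr).comp
    (tendsto_add_atTop_nat 1)).const_mul (A * Real.exp b))
  rw [mul_zero] at h
  filter_upwards [h.eventually (eventually_le_nhds hε)] with n hn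
  refine le_trans (le_of_eq ?_) hn
  simp only [Function.comp_apply, ← Real.exp_nat_mul]
  push_cast
  rw [show A * Real.exp b * (((n : ℝ) + 1) ^ j * Real.exp (((n : ℝ) + 1) * -b)) =
    A * ((n : ℝ) + 1) ^ j * (Real.exp b * Real.exp (((n : ℝ) + 1) * -b)) by ring,
    ← Real.exp_add]
  ring_nf

end Asymptotics

section Achievability

open Finset Filter Topology

theorem exists_successive_code [Fintype 𝒳] [DecidableEq 𝒳] [Fintype 𝒴] [Fintype 𝒮] [Nonempty 𝒮]
    {W : 𝒮 → 𝒳 → 𝒴 → ℝ} (hW : ∀ s, IsChannel (W s)) {P : 𝒳 → ℝ} (hP : IsPMF P) {n : ℕ}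
    (hn : 0 < n) {R e d δ : ℝ} (hR : 0 ≤ R) (hδ : 2 ≤ n * δ)
    (hdec : ∀ s, ∀ t ∈ acSet (fun z : 𝒳 × 𝒴 => P z.1 * W s z.1 z.2), margDev P t < δ →
      e ≤ typeExp P (W s) R t)
    (hdet : ∀ s s', s' ≠ s → ∃ ℓ ∈ Set.Icc (0 : ℝ) 1, ∀ p : 𝒳 → ℝ, IsPMF p →
      ∑ a, (p a - P a) ^ 2 < δ →
      d ≤ -∑ a, p a * Real.log (chernoffSum (W s a) (W s' a) ℓ)) :
    ∃ (M : ℕ) (f : Fin M → Fin n → 𝒳) (g : (Fin n → 𝒴) → 𝒮) (h : (Fin n → 𝒴) → Fin M),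
      0 < M ∧ R ≤ Real.log M / n ∧
      (∀ s i, biProbEvent W (f i) s (fun y => h y ≠ i) ≤
        32 * Fintype.card 𝒮 * (((n : ℝ) + 1) ^ Fintype.card (𝒳 × 𝒴)) ^ 2 *
          Real.exp (-(n * e))) ∧
      ∀ s i, biProbEvent W (f i) s (fun y => g y ≠ s) ≤
        32 * Fintype.card 𝒮 * (((n : ℝ) + 1) ^ Fintype.card (𝒳 × 𝒴)) ^ 2 *
          Real.exp (-(n * e)) + Fintype.card 𝒮 * Real.exp (-(n * d)) := by
  classical
  have hn' : (0 : ℝ) < n := by positivity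
  have hW0 : ∀ s a b, 0 ≤ W s a b := fun s a => (hW s a).1
  obtain ⟨μ, hμ, hμP, hμδ⟩ := exists_typical_pmf hP hn hδ
  have hM : 0 < ⌈Real.exp (n * R)⌉₊ := Nat.ceil_pos.2 (Real.exp_pos _)
  have hM4 : ((2 * ⌈Real.exp (n * R)⌉₊ : ℕ) : ℝ) ≤ 4 * Real.exp (n * R) := by
    have h1 := (Nat.ceil_lt_add_one (Real.exp_pos (n * R)).le).le
    have h2 : 1 ≤ Real.exp (n * R) := Real.one_le_exp (by positivity)
    push_cast
    linarith
  obtain ⟨f, h, hf, herr⟩ := exists_code (S := 𝒮) μ hμ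
    (fun s (x : Fin n → 𝒳) (y : Fin n → 𝒴) => ∏ i, W s (x i) (y i))
    (fun s x y => prod_nonneg fun i _ => hW0 _ _ _)
    (fun x y => letterCount fun i => (x i, y i)) hM
  obtain ⟨g, hg⟩ := exists_detector W hW0 f h
  have hdecode : ∀ s i, biProbEvent W (f i) s (fun y => h y ≠ i) ≤
      32 * Fintype.card 𝒮 * (((n : ℝ) + 1) ^ Fintype.card (𝒳 × 𝒴)) ^ 2 *
        Real.exp (-(n * e)) := fun s i => by
    have h1 := (herr s i).trans (mul_le_mul_of_nonneg_left (sum_le_sum fun s _ =>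
      decoding_bound hP.1 (hW0 s) hn (hdec s) μ hμ.1 hμP hμδ hM4) two_pos.le)
    rw [sum_const, card_univ, nsmul_eq_mul] at h1
    unfold biProbEvent
    refine le_trans (le_of_eq ?_) (h1.trans (le_of_eq (by ring)))
    exact sum_congr rfl fun y _ => by congr
  refine ⟨_, f, g, h, hM, ?_, hdecode, fun s i => (hg s i).trans
    (add_le_add (hdecode s i) ?_)⟩
  · rw [le_div_iff₀ hn', mul_comm]
    exact (Real.le_log_iff_exp_le (by exact_mod_cast hM)).2 (Nat.le_ceil _)
  · refine (sum_le_card_nsmul _ _ (Real.exp (-(n * d))) fun s' hs' => ?_).trans ?_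
    · obtain ⟨ℓ, hℓ, hd⟩ := hdet s s' (ne_of_mem_erase hs')
      exact detection_pair_bound (hW0 s) (hW0 s') hn (f i) hℓ
        (hd _ (empDist_isPMF hn _) (hμδ _ (hf i).ne'))
    · rw [nsmul_eq_mul]
      gcongr
      exact card_le_univ _

theorem biAchievable_of_le_exponents [Fintype 𝒳] [Fintype 𝒴] [Fintype 𝒮] [Nonempty 𝒮]
    {W : 𝒮 → 𝒳 → 𝒴 → ℝ} (hW : ∀ s, IsChannel (W s)) {P : 𝒳 → ℝ} (hP : IsPMF P) {R E : ℝ}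
    (hR0 : 0 < R) (hR : R ≤ ⨅ s, mutualInfo P (W s)) (hE1 : ENNReal.ofReal E ≤ rhoSucc W P R)
    (hE2 : E ≤ phi W P) : BiAchievable W R E := by
  classical
  intro ε hε
  set R' := max 0 (R - ε) with hR'
  set c := max 0 (E - ε / 2) with hc
  have hR's : R' < R := max_lt hR0 (by linarith)
  have hcE : 0 < c → c < E := fun h => by
    rcases lt_max_iff.1 h with h' | h'
    · exact absurd h' (lt_irrefl _)
    · rw [hc, max_eq_right h'.le]
      linarith
  have hdec : ∀ s, ∀ᶠ m in 𝓝[>] (0 : ℝ), ∀ t ∈ acSet (fun z : 𝒳 × 𝒴 => P z.1 * W s z.1 z.2),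
      margDev P t < m → c + m ≤ typeExp P (W s) R' t := fun s =>
    eventually_add_le_of_isCompact (isCompact_acSet _) (continuous_typeExp _ _ _)
      (continuous_margDev P) (margDev_nonneg P) fun t ht h =>
      lt_typeExp hW hP (fun s => hR.trans (ciInf_le (Set.finite_range _).bddBelow s)) hR's hE1
        hcE s ht h
  have hdet : ∀ s s', ∀ᶠ m in 𝓝[>] (0 : ℝ), s' ≠ s → ∃ ℓ ∈ Set.Icc (0 : ℝ) 1,
      ∀ p : 𝒳 → ℝ, IsPMF p → ∑ a, (p a - P a) ^ 2 < m →
        E - ε / 2 + m ≤ -∑ a, p a * Real.log (chernoffSum (W s a) (W s' a) ℓ) := fun s s' => by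
    by_cases hs : s' = s
    · exact Eventually.of_forall fun m h => absurd hs h
    obtain ⟨ℓ, hℓ, h⟩ := exists_chernoff_gt ((sub_lt_self E (half_pos hε)).trans_le hE2) hs
    filter_upwards [eventually_add_le_of_isCompact (isCompact_setOf_isPMF (𝒳 := 𝒳))
      (F := fun p => -∑ a, p a * Real.log (chernoffSum (W s a) (W s' a) ℓ))
      (g := fun p => ∑ a, (p a - P a) ^ 2) (c := E - ε / 2) (by fun_prop) (by fun_prop)
      (fun p => sum_nonneg fun a _ => sq_nonneg _) fun p _ hp => by
        have : p = P := funext fun a => sub_eq_zero.1 <| pow_eq_zero_iff two_ne_zero |>.1 <|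
          (sum_eq_zero_iff_of_nonneg fun a _ => sq_nonneg _).1 hp a (mem_univ a)
        rwa [this]] with m hm _
    exact ⟨ℓ, hℓ, hm⟩
  obtain ⟨m, ⟨hm1, hm2⟩, hm0⟩ := (((eventually_all.2 hdec).and (eventually_all.2 fun s =>
    eventually_all.2 (hdet s))).and self_mem_nhdsWithin).exists
  have hm0 : 0 < m := hm0
  set k := Fintype.card (𝒳 × 𝒴)
  obtain ⟨n, ⟨hn1, hn2⟩, hn0⟩ := (((eventually_mul_pow_mul_exp_le (33 * Fintype.card 𝒮) (k * 2)
    (lt_min hm0 (half_pos hε)) (lt_min one_pos hε)).and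
    (tendsto_natCast_atTop_atTop.eventually_ge_atTop (2 / m))).and
    (eventually_gt_atTop 0)).exists
  have hn' : (0 : ℝ) < n := by positivity
  obtain ⟨M, f, g, h, hM, hrate, hPc, hPd⟩ := exists_successive_code hW hP hn0
    (le_max_left 0 (R - ε)) ((div_le_iff₀ hm0).1 hn2) hm1
    (fun s s' hs => hm2 s s' hs)
  set N : ℝ := ((n : ℝ) + 1) ^ k with hN
  have hN1 : 1 ≤ N := one_le_pow₀ (by linarith)
  rw [pow_mul, ← hN] at hn1
  refine ⟨n, M, f, g, h, hn0, hM, (le_max_right _ _).trans hrate, fun s i => ?_, fun s i => ?_⟩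
  · calc _ ≤ _ := hPc s i
      _ ≤ 33 * Fintype.card 𝒮 * N ^ 2 * Real.exp (-(n * min m (ε / 2))) := by
        gcongr
        · norm_num
        · exact (min_le_left _ _).trans (le_add_of_nonneg_left (le_max_left _ _))
      _ ≤ ε := hn1.trans (min_le_right _ _)
  · calc _ ≤ _ := hPd s i
      _ ≤ 32 * Fintype.card 𝒮 * N ^ 2 * Real.exp (-(n * (E - ε / 2))) +
          Fintype.card 𝒮 * N ^ 2 * Real.exp (-(n * (E - ε / 2))) := by
        gcongr
        · exact (le_max_right _ _).trans (le_add_of_nonneg_right hm0.le)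
        · exact le_mul_of_one_le_right (Nat.cast_nonneg _) (one_le_pow₀ hN1)
        · exact le_add_of_nonneg_right hm0.le
      _ = 33 * Fintype.card 𝒮 * N ^ 2 * Real.exp (-(n * (ε / 2))) *
          Real.exp (-n * (E - ε)) := by
        rw [mul_assoc _ (Real.exp _), ← Real.exp_add]
        ring_nf
      _ ≤ 1 * Real.exp (-n * (E - ε)) := by
        gcongr
        refine le_trans ?_ (hn1.trans (min_le_left _ _))
        gcongr
        exact min_le_right _ _
      _ = _ := one_mul _

end Achievability

/-- Theorem 6 of the paper: bi-static successive-scheme inner bound. -/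
theorem biStatic_successive_innerBound
    [Fintype 𝒳] [Fintype 𝒴] [Fintype 𝒮] [Nonempty 𝒳] [Nonempty 𝒮]
    (W : 𝒮 → 𝒳 → 𝒴 → ℝ) (hW : ∀ s, IsChannel (W s))
    (hSA : StandingAssumption W)
    (P : 𝒳 → ℝ) (hP : IsPMF P)
    (R E : ℝ) (hR0 : 0 < R) (hE0 : 0 ≤ E)
    (hR : R ≤ ⨅ s, mutualInfo P (W s))
    (hE1 : ENNReal.ofReal E ≤ rhoSucc W P R)
    (hE2 : E ≤ phi W P) :
    (R, E) ∈ Cbi W := by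
  exact subset_closure ⟨hR0.le, hE0, biAchievable_of_le_exponents hW hP hR0 hR hE1 hE2⟩

end JCAS
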